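/- arXiv:1207.1930 — 2 statements merged into one kernel-verified Lean document; each statement's English description precedes it below -/
import Mathlib

section
/- Let A be a simple σ-unital C*-algebra and h a non-zero positive element of A. Then every densely defined lower semicontinuous trace on the hereditary subalgebra hAh⁻ (the norm closure of hAh) is the restriction of some densely defined lower semicontinuous trace on A. -/
open scoped MultiplierAlgebra Kronecker
open Filter Topology
open scoped ENNReal NNReal

set_option linter.unusedSectionVars false
set_option synthInstance.maxHeartbeats 1000000
set_option maxHeartbeats 1000000

noncomputable section

universe u v w

namespace Paper

section B1


variable (A : Type*) [NonUnitalCStarAlgebra A] [PartialOrder A] [StarOrderedRing A]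

/-- A C*-algebra is simple if it is nonzero and has no nontrivial closed two-sided ideals. -/
def IsSimpleCStar : Prop :=
  (∃ a : A, a ≠ 0) ∧
    ∀ I : Submodule ℂ A, (∀ x ∈ I, ∀ a : A, a * x ∈ I ∧ x * a ∈ I) →
      IsClosed (I : Set A) → I = ⊥ ∨ I = ⊤

/-- σ-unital: existence of a strictly positive element, i.e. `h ≥ 0` with `hAh` dense. -/
def SigmaUnital : Prop :=
  ∃ h : A, 0 ≤ h ∧ Dense (Set.range fun a : A => h * a * h)

/-- The hereditary C*-subalgebra `\overline{hAh}` generated by a positive element `h`. -/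
def HereditarySub (h : A) : Set A := closure (Set.range fun a : A => h * a * h)

/-- A general hereditary C*-subalgebra. -/
structure IsHereditarySubalgebra (S : Set A) : Prop where
  isClosed : IsClosed S
  zero_mem : (0 : A) ∈ S
  add_mem : ∀ x ∈ S, ∀ y ∈ S, x + y ∈ S
  smul_mem : ∀ (c : ℂ), ∀ x ∈ S, c • x ∈ S
  mul_mem : ∀ x ∈ S, ∀ y ∈ S, x * y ∈ S
  star_mem : ∀ x ∈ S, star x ∈ S
  hereditary : ∀ a b : A, 0 ≤ a → a ≤ b → b ∈ S → a ∈ S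

/-- A densely defined lower semicontinuous trace on (a subalgebra `S` of) `A`;
the function is only meaningful on positive elements of `S`. -/
structure LscTraceOn (S : Set A) where
  toFun : A → ℝ≥0∞
  map_add : ∀ a ∈ S, ∀ b ∈ S, 0 ≤ a → 0 ≤ b → toFun (a + b) = toFun a + toFun b
  map_smul : ∀ (r : ℝ≥0), ∀ a ∈ S, 0 ≤ a → toFun (((r : ℝ) : ℂ) • a) = r * toFun a
  tracial : ∀ x : A, x ∈ S → toFun (star x * x) = toFun (x * star x)
  lsc : LowerSemicontinuousOn toFun {a | a ∈ S ∧ 0 ≤ a}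
  densely_defined : ∀ a ∈ S, 0 ≤ a → a ∈ closure {b | b ∈ S ∧ 0 ≤ b ∧ toFun b ≠ ∞}

/-- A densely defined lower semicontinuous trace on `A`. -/
abbrev LscTrace := LscTraceOn A Set.univ

/-- A trace is nontrivial (nonzero) if it does not vanish on all positive elements. -/
def LscTraceOn.Nontrivial {S : Set A} (T : LscTraceOn A S) : Prop :=
  ∃ c : A, 0 ≤ c ∧ T.toFun c ≠ 0

/-- A tracial state on `A`. -/
structure TracialState where
  toFun : A →L[ℂ] ℂ
  tracial : ∀ a b : A, toFun (a * b) = toFun (b * a)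
  pos : ∀ a : A, 0 ≤ a → 0 ≤ (toFun a).re ∧ (toFun a).im = 0
  norm_one : ‖toFun‖ = 1

/-- Every densely defined lower semicontinuous trace on `A` is bounded. -/
def NoUnboundedTrace : Prop :=
  ∀ T : LscTrace A, ∃ C : ℝ≥0, ∀ a : A, 0 ≤ a → ‖a‖ ≤ 1 → T.toFun a ≤ C

variable (AK : Type*) [NonUnitalCStarAlgebra AK] [PartialOrder AK] [StarOrderedRing AK]

/-- A model for the stabilization `A ⊗ K`: the algebra `AK` is generated by a system of
"matrix corners" `ι a i j` (corresponding to `a ⊗ e_{ij}`). -/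
structure Stabilization where
  ι : A → ℕ → ℕ → AK
  ι_add : ∀ a b i j, ι (a + b) i j = ι a i j + ι b i j
  ι_smul : ∀ (c : ℂ) a i j, ι (c • a) i j = c • ι a i j
  ι_mul : ∀ (a b : A) (i j k l : ℕ), ι a i j * ι b k l = if j = k then ι (a * b) i l else 0
  ι_star : ∀ a i j, star (ι a i j) = ι (star a) j i
  ι_norm : ∀ a i j, ‖ι a i j‖ = ‖a‖
  dense_span : Dense (Submodule.span ℂ {x : AK | ∃ a i j, x = ι a i j} : Set AK)

variable {A AK}

/-- Cuntz subequivalence of positive elements. -/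
def CuntzLE (a b : AK) : Prop :=
  ∃ x : ℕ → AK, Tendsto (fun n => ‖star (x n) * b * x n - a‖) atTop (𝓝 0)

/-- Cuntz equivalence of positive elements. -/
def CuntzEquiv (a b : AK) : Prop := CuntzLE a b ∧ CuntzLE b a

variable (AK)

/-- The Cuntz semigroup is almost unperforated: `(k+1)[a] ≤ k[b]` implies `[a] ≤ [b]`.
Sums of copies of a class are realized by sums of pairwise orthogonal Cuntz-equivalent
elemets of the stable algebra. -/
def CuAlmostUnperforated : Prop :=
  ∀ (k : ℕ), 0 < k → ∀ (a b : AK), 0 ≤ a → 0 ≤ b →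
    ∀ (u : Fin (k + 1) → AK) (v : Fin k → AK),
      (∀ i, 0 ≤ u i ∧ CuntzEquiv (u i) a) → (∀ i j, i ≠ j → u i * u j = 0) →
      (∀ i, 0 ≤ v i ∧ CuntzEquiv (v i) b) → (∀ i j, i ≠ j → v i * v j = 0) →
      CuntzLE (∑ i, u i) (∑ i, v i) → CuntzLE a b

/-- `A ⊗ K` contains no nonzero projections. -/
def StablyProjectionless : Prop :=
  ∀ p : AK, star p = p → p * p = p → p = 0

variable {AK}

/-- The dimension function `d_τ(a) = lim_n τ(a^{1/n})` associated to a densely defined lower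
semicontinuous trace (on the stabilization). -/
def dimTrace (T : LscTrace AK) (a : AK) : ℝ≥0∞ :=
  ⨆ n : ℕ, T.toFun (cfcₙ (fun t : ℝ => t ^ ((n : ℝ) + 1)⁻¹) a)

variable (AK)

/-- Strict comparison of positive elements by (nonzero) traces. -/
def StrictComparison : Prop :=
  ∀ a b : AK, 0 ≤ a → 0 ≤ b →
    (∀ T : LscTrace AK, T.Nontrivial →
      dimTrace T a < dimTrace T b ∧ dimTrace T b ≠ ∞) →
    CuntzLE a b

/-- Almost stable rank one: every σ-unital hereditary subalgebra `B` of `A ⊗ K` satisfies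
`B ⊆ closure (GL(B^~))`. -/
def AlmostStableRankOne : Prop :=
  ∀ h : AK, 0 ≤ h → ∀ b ∈ HereditarySub AK h, ∀ ε : ℝ, 0 < ε →
    ∃ z w : Unitization ℂ AK, z.snd ∈ HereditarySub AK h ∧ w.snd ∈ HereditarySub AK h ∧
      z * w = 1 ∧ w * z = 1 ∧ ‖z - (b : Unitization ℂ AK)‖ < ε

variable {AK}

variable (A) in
/-- The hereditary subalgebra generated by `h` is isomorphic to `A`. -/
def HerIso (h : AK) : Prop :=
  ∃ f : A →⋆ₙₐ[ℂ] AK, Isometry f ∧ Set.range f = HereditarySub AK h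

variable (A) in
/-- The fundamental group (as a subset of `(0,∞]`):
`{ d_τ(h) : h positive in A ⊗ K, \overline{h(A⊗K)h} ≅ A }`. -/
def FundSet (τK : LscTrace AK) : Set ℝ≥0∞ :=
  {r | ∃ h : AK, 0 ≤ h ∧ HerIso A h ∧ r = dimTrace τK h}


end B1

section HereditarySubalgebra

variable {A : Type*} [NonUnitalCStarAlgebra A]

/-- The hereditary subalgebra generated by a self-adjoint element, as a star subalgebra. -/
def hereditaryStarSubalgebra (h : A) (hh : IsSelfAdjoint h) : NonUnitalStarSubalgebra ℂ A :=
  NonUnitalStarSubalgebra.topologicalClosure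
    { carrier := Set.range fun a : A => h * a * h
      zero_mem' := ⟨0, by simp⟩
      add_mem' := by
        rintro _ _ ⟨a, rfl⟩ ⟨b, rfl⟩
        exact ⟨a + b, by simp [mul_add, add_mul]⟩
      mul_mem' := by
        rintro _ _ ⟨a, rfl⟩ ⟨b, rfl⟩
        exact ⟨a * h * h * b, by simp [mul_assoc]⟩
      smul_mem' := by
        rintro c _ ⟨a, rfl⟩
        exact ⟨c • a, by simp [mul_smul_comm, smul_mul_assoc]⟩
      star_mem' := by
        rintro _ ⟨a, rfl⟩
        exact ⟨star a, by simp [hh.star_eq, mul_assoc]⟩ }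

variable [PartialOrder A] [StarOrderedRing A]

lemma isClosed_hereditarySub (h : A) : IsClosed (HereditarySub A h) := isClosed_closure

lemma mul_mul_mem_hereditarySub (h a : A) : h * a * h ∈ HereditarySub A h :=
  subset_closure ⟨a, rfl⟩

lemma conj_mem_hereditarySub {h : A} (hh : IsSelfAdjoint h) {c : A} (hc : c ∈ HereditarySub A h)
    (z : A) : c * z * star c ∈ HereditarySub A h := by
  refine map_mem_closure (f := fun c : A => c * z * star c) (by fun_prop) hc ?_
  rintro _ ⟨a, rfl⟩
  exact ⟨a * h * z * h * star a, by simp [hh.star_eq, mul_assoc]⟩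

lemma sqrt_mem_hereditarySub {h : A} (hh : IsSelfAdjoint h) {b : A} (hb : b ∈ HereditarySub A h)
    (hb0 : 0 ≤ b) : CFC.sqrt b ∈ HereditarySub A h := by
  rw [CFC.sqrt_eq_real_sqrt b hb0]
  have : IsClosed (hereditaryStarSubalgebra h hh : Set A) := isClosed_hereditarySub h
  exact cfcₙ_mem (s := hereditaryStarSubalgebra h hh) _ hb

lemma mul_mem_hereditarySub_of_mem_left {h c : A} (hc : c ∈ HereditarySub A h) (a : A) :
    c * (a * h) ∈ HereditarySub A h := by
  refine map_mem_closure (f := fun c : A => c * (a * h)) (by fun_prop) hc ?_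
  rintro _ ⟨d, rfl⟩
  exact ⟨d * h * a, by simp [mul_assoc]⟩

end HereditarySubalgebra

section LscTraceOn

variable {A : Type*} [NonUnitalCStarAlgebra A] [PartialOrder A] [StarOrderedRing A]
  {h : A} (T : LscTraceOn A (HereditarySub A h))

lemma LscTraceOn.map_zero (hh : IsSelfAdjoint h) : T.toFun 0 = 0 := by
  simpa using T.map_smul 0 0 (zero_mem (hereditaryStarSubalgebra h hh)) le_rfl

lemma LscTraceOn.mono (hh : IsSelfAdjoint h) {a b : A} (ha : a ∈ HereditarySub A h)
    (hb : b ∈ HereditarySub A h) (ha0 : 0 ≤ a) (hab : a ≤ b) : T.toFun a ≤ T.toFun b := by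
  have := T.map_add a ha (b - a) (sub_mem (S := NonUnitalStarSubalgebra ℂ A)
    (H := hereditaryStarSubalgebra h hh) hb ha) ha0 (sub_nonneg.2 hab)
  rw [add_sub_cancel] at this
  exact this ▸ le_self_add

lemma LscTraceOn.map_sum (hh : IsSelfAdjoint h) {ι : Type*} {b : ι → A}
    (hb : ∀ i, b i ∈ HereditarySub A h) (hb0 : ∀ i, 0 ≤ b i) (s : Finset ι) :
    T.toFun (∑ i ∈ s, b i) = ∑ i ∈ s, T.toFun (b i) := by
  classical
  induction s using Finset.induction_on with
  | empty => simpa using T.map_zero hh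
  | insert i s hi ih =>
    rw [Finset.sum_insert hi, Finset.sum_insert hi, ← ih]
    exact T.map_add _ (hb i) _ (sum_mem (S := hereditaryStarSubalgebra h hh) fun i _ => hb i)
      (hb0 i) (Finset.sum_nonneg fun i _ => hb0 i)

lemma LscTraceOn.eq_tsum_of_tendsto (hh : IsSelfAdjoint h) {b : ℕ → A} {s : A}
    (hb : ∀ i, b i ∈ HereditarySub A h) (hb0 : ∀ i, 0 ≤ b i)
    (hs : Tendsto (fun N => ∑ i ∈ Finset.range N, b i) atTop (𝓝 s)) :
    T.toFun s = ∑' i, T.toFun (b i) := by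
  have hmem : ∀ N, ∑ i ∈ Finset.range N, b i ∈ HereditarySub A h := fun N =>
    sum_mem (S := hereditaryStarSubalgebra h hh) fun i _ => hb i
  have hnn : ∀ N, 0 ≤ ∑ i ∈ Finset.range N, b i := fun N => Finset.sum_nonneg fun i _ => hb0 i
  have hsmem : s ∈ HereditarySub A h :=
    (isClosed_hereditarySub h).mem_of_tendsto hs (Eventually.of_forall hmem)
  have hmono : Monotone fun N => ∑ i ∈ Finset.range N, b i :=
    monotone_nat_of_le_succ fun N => by simp [Finset.sum_range_succ, hb0]
  have hle : ∀ N, ∑ i ∈ Finset.range N, b i ≤ s := hmono.ge_of_tendsto hs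
  apply le_antisymm
  · refine le_of_forall_lt fun y hy => ?_
    have hev := T.lsc s ⟨hsmem, (hnn 0).trans (hle 0)⟩ y hy
    have ht : Tendsto (fun N => ∑ i ∈ Finset.range N, b i) atTop
        (𝓝[{a | a ∈ HereditarySub A h ∧ 0 ≤ a}] s) :=
      tendsto_nhdsWithin_iff.2 ⟨hs, Eventually.of_forall fun N => ⟨hmem N, hnn N⟩⟩
    obtain ⟨N, hN⟩ := (ht.eventually hev).exists
    rw [T.map_sum hh hb hb0] at hN
    exact hN.trans_le (ENNReal.sum_le_tsum _)
  · rw [ENNReal.tsum_eq_iSup_nat]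
    refine iSup_le fun N => ?_
    rw [← T.map_sum hh hb hb0]
    exact T.mono hh (hmem N) hsmem (hnn N) (hle N)

end LscTraceOn

section Frame

variable {A : Type*} [NonUnitalCStarAlgebra A] [PartialOrder A] [StarOrderedRing A]

/-- The partial sums of `frameFun n t ^ 2 * t`; they increase to `1` for `t > 0`. -/
def frameSumFun (N : ℕ) (t : ℝ) : ℝ := N * t ^ 2 / (1 + N * t ^ 2)

/-- The `n`-th function of the frame; it vanishes for `t ≤ 0`. -/
def frameFun (n : ℕ) (t : ℝ) : ℝ :=
  √(t / ((1 + n * t ^ 2) * (1 + (n + 1) * t ^ 2)))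

lemma one_add_mul_sq_pos (N : ℕ) (t : ℝ) : 0 < 1 + N * t ^ 2 := by positivity

lemma one_add_succ_mul_sq_pos (N : ℕ) (t : ℝ) : 0 < 1 + ((N : ℝ) + 1) * t ^ 2 := by positivity

@[fun_prop]
lemma continuous_frameSumFun (N : ℕ) : Continuous (frameSumFun N) := by
  unfold frameSumFun
  exact Continuous.div (by fun_prop) (by fun_prop) fun t => (one_add_mul_sq_pos N t).ne'

@[fun_prop]
lemma continuous_frameFun (n : ℕ) : Continuous (frameFun n) := by
  unfold frameFun
  refine (Continuous.div (by fun_prop) (by fun_prop) fun t => ?_).sqrt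
  exact (mul_pos (one_add_mul_sq_pos n t) (one_add_succ_mul_sq_pos n t)).ne'

@[simp] lemma frameSumFun_zero_right (N : ℕ) : frameSumFun N 0 = 0 := by simp [frameSumFun]

@[simp] lemma frameFun_zero_right (n : ℕ) : frameFun n 0 = 0 := by simp [frameFun]

lemma frameSumFun_succ (N : ℕ) {t : ℝ} (ht : 0 ≤ t) :
    frameSumFun (N + 1) t = frameSumFun N t + frameFun N t * t * frameFun N t := by
  have h1 := one_add_mul_sq_pos N t
  have h2 := one_add_succ_mul_sq_pos N t
  have h3 : frameFun N t * t * frameFun N t =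
      t / ((1 + N * t ^ 2) * (1 + (N + 1) * t ^ 2)) * t := by
    rw [mul_right_comm, frameFun, Real.mul_self_sqrt (by positivity)]
  rw [h3]
  simp only [frameSumFun]
  push_cast
  field_simp
  ring

lemma norm_frameSumFun_le (N : ℕ) (t : ℝ) : ‖frameSumFun N t‖ ≤ 1 := by
  rw [Real.norm_of_nonneg (by unfold frameSumFun; positivity), frameSumFun,
    div_le_one (one_add_mul_sq_pos N t)]
  linarith

lemma norm_conj_frameSumFun_le (N : ℕ) (hN : 0 < N) {t : ℝ} (ht : 0 ≤ t) :
    ‖t - frameSumFun N t * t - t * frameSumFun N t + frameSumFun N t * t * frameSumFun N t‖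
      ≤ 1 / √N := by
  have h1 := one_add_mul_sq_pos N t
  have : t - frameSumFun N t * t - t * frameSumFun N t + frameSumFun N t * t * frameSumFun N t
      = t / (1 + N * t ^ 2) ^ 2 := by
    simp only [frameSumFun]
    field_simp
    ring
  rw [this, Real.norm_of_nonneg (by positivity)]
  have hs : 0 < √(N : ℝ) := Real.sqrt_pos.2 (by exact_mod_cast hN)
  have hsq : √(N : ℝ) ^ 2 = N := Real.sq_sqrt (by positivity)
  rw [div_le_div_iff₀ (by positivity) hs, ← hsq]
  generalize √(N : ℝ) = s at hs
  rw [Real.sqrt_sq hs.le, ← mul_pow, one_mul, mul_comm t s]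
  nlinarith [sq_nonneg (s * t - 1), sq_nonneg (s * t), sq_nonneg ((s * t) ^ 2)]

variable (p : A)

lemma sum_frameFun_conj (hp : 0 ≤ p) (N : ℕ) :
    ∑ n ∈ Finset.range N, cfcₙ (frameFun n) p * p * cfcₙ (frameFun n) p =
      cfcₙ (frameSumFun N) p := by
  have hsa : IsSelfAdjoint p := .of_nonneg hp
  induction N with
  | zero =>
    have : frameSumFun 0 = fun _ => 0 := by ext; simp [frameSumFun]
    simp [this]
  | succ N ih =>
    have heq : cfcₙ (frameSumFun (N + 1)) p =
        cfcₙ (fun t => frameSumFun N t + frameFun N t * t * frameFun N t) p :=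
      cfcₙ_congr fun t ht => frameSumFun_succ N (quasispectrum_nonneg_of_nonneg p hp t ht)
    rw [Finset.sum_range_succ, ih, heq, cfcₙ_add .., cfcₙ_mul .., cfcₙ_mul .., cfcₙ_id' ℝ p]

lemma norm_cfcₙ_frameSumFun_le (N : ℕ) : ‖cfcₙ (frameSumFun N) p‖ ≤ 1 :=
  norm_cfcₙ_le fun t _ => norm_frameSumFun_le N t

variable {p}

lemma tendsto_cfcₙ_frameSumFun_mul (hp : 0 ≤ p) {y : A} (hy : y * star y ≤ p) :
    Tendsto (fun N => cfcₙ (frameSumFun N) p * y) atTop (𝓝 y) := by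
  have hsa : IsSelfAdjoint p := .of_nonneg hp
  have key : ∀ N : ℕ, 0 < N → ‖y - cfcₙ (frameSumFun N) p * y‖ ≤ √(1 / √N) := by
    intro N hN
    set f := cfcₙ (frameSumFun N) p with hf
    have hfsa : star f = f := (cfcₙ_predicate (p := IsSelfAdjoint) _ p).star_eq
    have hcfc : p - f * p - p * f + f * p * f = cfcₙ (fun t => t - frameSumFun N t * t -
        t * frameSumFun N t + frameSumFun N t * t * frameSumFun N t) p := by
      rw [cfcₙ_add .., cfcₙ_sub .., cfcₙ_sub .., cfcₙ_mul .., cfcₙ_mul .., cfcₙ_mul ..,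
        cfcₙ_mul .., cfcₙ_id' ℝ p]
    have hnorm : ‖p - f * p - p * f + f * p * f‖ ≤ 1 / √N := by
      rw [hcfc]
      exact norm_cfcₙ_le fun t ht =>
        norm_conj_frameSumFun_le N hN (quasispectrum_nonneg_of_nonneg p hp t ht)
    have hpos : ∀ z : A, 0 ≤ z → 0 ≤ z - f * z - z * f + f * z * f := by
      intro z hz
      set w := CFC.sqrt z
      have hw : star w = w := (IsSelfAdjoint.of_nonneg (CFC.sqrt_nonneg z)).star_eq
      have hww : w * w = z := CFC.sqrt_mul_sqrt_self z hz
      convert mul_star_self_nonneg (w - f * w) using 1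
      rw [← hww]
      simp only [star_sub, star_mul, hfsa, hw]
      noncomm_ring
    have hle : (y - f * y) * star (y - f * y) ≤ p - f * p - p * f + f * p * f := by
      rw [← sub_nonneg]
      convert hpos (p - y * star y) (sub_nonneg.2 hy) using 1
      simp only [star_sub, star_mul, hfsa]
      noncomm_ring
    apply Real.le_sqrt_of_sq_le
    rw [sq, ← CStarRing.norm_self_mul_star]
    exact (CStarAlgebra.norm_le_norm_of_nonneg_of_le (mul_star_self_nonneg _) hle).trans hnorm
  rw [tendsto_iff_norm_sub_tendsto_zero]
  have hlim : Tendsto (fun N : ℕ => √(1 / √(N : ℝ))) atTop (𝓝 0) := by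
    have h1 : Tendsto (fun N : ℕ => √(N : ℝ)) atTop atTop :=
      Real.tendsto_sqrt_atTop.comp tendsto_natCast_atTop_atTop
    simpa using (h1.inv_tendsto_atTop).sqrt
  refine squeeze_zero' (Eventually.of_forall fun _ => norm_nonneg _) ?_ hlim
  filter_upwards [eventually_gt_atTop 0] with N hN
  rw [norm_sub_rev]
  exact key N hN

/-- The right ideal on which contractions `f N` converge strongly to the identity is closed. -/
lemma isClosed_setOf_tendsto_mul {f : ℕ → A} (hf : ∀ N, ‖f N‖ ≤ 1) :
    IsClosed {a : A | Tendsto (fun N => f N * a) atTop (𝓝 a)} := by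
  refine isClosed_of_closure_subset fun a ha => ?_
  rw [Set.mem_ofPred_eq, Metric.tendsto_atTop]
  intro ε hε
  obtain ⟨b, hb, hab⟩ := Metric.mem_closure_iff.1 ha (ε / 3) (by positivity)
  obtain ⟨M, hM⟩ := Metric.tendsto_atTop.1 hb (ε / 3) (by positivity)
  refine ⟨M, fun N hN => ?_⟩
  have h1 : dist (f N * a) (f N * b) ≤ dist a b := by
    rw [dist_eq_norm, dist_eq_norm, ← mul_sub]
    exact (norm_mul_le _ _).trans (mul_le_of_le_one_left (norm_nonneg _) (hf N))
  calc dist (f N * a) a ≤ dist (f N * a) (f N * b) + dist (f N * b) b + dist b a :=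
        dist_triangle4 ..
    _ < ε := by linarith [hM N hN, dist_comm a b]

/-- In a simple C*-algebra, any element is in the closed span of countably many `a * h * b`. -/
lemma exists_seq_mem_closure_span (hA : IsSimpleCStar A) {h : A} (hpos : 0 ≤ h) (hne : h ≠ 0)
    (e : A) : ∃ a b : ℕ → A,
      e ∈ closure (Submodule.span ℂ (Set.range fun j => a j * h * b j) : Set A) := by
  have hsa : star h = h := (IsSelfAdjoint.of_nonneg hpos).star_eq
  set S : Set A := {x | ∃ a b, x = a * h * b}
  set I := (Submodule.span ℂ S).topologicalClosure
  have hspan : ∀ x ∈ Submodule.span ℂ S, ∀ a : A,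
      a * x ∈ Submodule.span ℂ S ∧ x * a ∈ Submodule.span ℂ S := by
    intro x hx a
    induction hx using Submodule.span_induction with
    | mem x hx =>
      obtain ⟨c, d, rfl⟩ := hx
      exact ⟨Submodule.subset_span ⟨a * c, d, by simp [mul_assoc]⟩,
        Submodule.subset_span ⟨c, d * a, by simp [mul_assoc]⟩⟩
    | zero => simp
    | add x y _ _ hx hy =>
      rw [mul_add, add_mul]
      exact ⟨add_mem hx.1 hy.1, add_mem hx.2 hy.2⟩
    | smul c x _ hx =>
      rw [mul_smul_comm, smul_mul_assoc]
      exact ⟨Submodule.smul_mem _ _ hx.1, Submodule.smul_mem _ _ hx.2⟩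
  have hI : I = ⊤ := by
    refine (hA.2 I (fun x hx a => ⟨?_, ?_⟩) (Submodule.isClosed_topologicalClosure _)).resolve_left
      fun hbot => ?_
    · exact map_mem_closure (f := fun x => a * x) (by fun_prop) hx fun x hx => (hspan x hx a).1
    · exact map_mem_closure (f := fun x => x * a) (by fun_prop) hx fun x hx => (hspan x hx a).2
    · have hmem : (h * h) * h * h ∈ I :=
        subset_closure (Submodule.subset_span ⟨h * h, h, rfl⟩)
      rw [hbot, Submodule.mem_bot, mul_assoc] at hmem
      have h2 : star (h * h) * (h * h) = 0 := by rw [star_mul, hsa, hmem]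
      have h3 : star h * h = 0 := by rw [hsa, (CStarRing.star_mul_self_eq_zero_iff _).1 h2]
      exact hne ((CStarRing.star_mul_self_eq_zero_iff _).1 h3)
  have he : e ∈ closure (Submodule.span ℂ S : Set A) := by
    change e ∈ I
    simp [hI]
  obtain ⟨s, hs, hse⟩ := mem_closure_iff_seq_limit.1 he
  choose F hFS hF using fun n => Submodule.mem_span_finite_of_mem_span (hs n)
  have hcount : (insert 0 (⋃ n, (F n : Set A))).Countable :=
    (Set.countable_iUnion fun n => (F n).countable_toSet).insert 0
  obtain ⟨u, hu⟩ := hcount.exists_eq_range (Set.insert_nonempty _ _)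
  have huS : ∀ j, u j ∈ S := by
    intro j
    have : u j ∈ insert 0 (⋃ n, (F n : Set A)) := hu ▸ Set.mem_range_self j
    rcases this with h0 | hj
    · exact ⟨0, 0, by simp [h0]⟩
    · obtain ⟨n, hn⟩ := Set.mem_iUnion.1 hj
      exact hFS n hn
  choose a b hab using huS
  refine ⟨a, b, mem_closure_of_tendsto hse (Eventually.of_forall fun n => ?_)⟩
  refine Submodule.span_mono ?_ (hF n)
  have : (fun j => a j * h * b j) = u := funext fun j => (hab j).symm
  rw [this, ← hu]
  exact (Set.subset_iUnion (fun n => (F n : Set A)) n).trans (Set.subset_insert _ _)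

/-- A countable family `g n * y j` with `y j` in `A * h`, such that the sum of all
`(g n * y j) * star (g n * y j)` is the unit of the multiplier algebra. -/
lemma exists_frame (hA : IsSimpleCStar A) (hσ : SigmaUnital A) {h : A} (hpos : 0 ≤ h)
    (hne : h ≠ 0) : ∃ (y g : ℕ → A) (p : A), (∀ j, ∃ a, y j = a * h) ∧
      (∀ n, IsSelfAdjoint (g n)) ∧ HasSum (fun j => y j * star (y j)) p ∧
      ∀ c : A, Tendsto (fun N => ∑ n ∈ Finset.range N, c * (g n * p * g n) * star c) atTop
        (𝓝 (c * star c)) := by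
  obtain ⟨e, -, hdense⟩ := hσ
  obtain ⟨a, b, hab⟩ := exists_seq_mem_closure_span hA hpos hne e
  let r : ℕ → ℝ := fun j => (1 / 2) ^ j / (1 + ‖a j * h‖)
  have hr : ∀ j, 0 < r j := fun j => by positivity
  let y : ℕ → A := fun j => r j • (a j * h)
  have hy : ∀ j, ‖y j‖ ≤ (1 / 2) ^ j := by
    intro j
    rw [norm_smul, Real.norm_of_nonneg (hr j).le, div_mul_eq_mul_div, div_le_iff₀ (by positivity)]
    gcongr
    linarith
  have hsumm : Summable fun j => y j * star (y j) := by
    refine Summable.of_norm_bounded summable_geometric_two fun j => ?_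
    rw [CStarRing.norm_self_mul_star]
    exact (mul_le_of_le_one_left (norm_nonneg _)
      ((hy j).trans (pow_le_one₀ (by norm_num) (by norm_num)))).trans (hy j)
  obtain ⟨p, hp⟩ := hsumm
  have hnn : ∀ j, 0 ≤ y j * star (y j) := fun j => mul_star_self_nonneg _
  have hp0 : 0 ≤ p := hp.nonneg hnn
  have hyp : ∀ j, y j * star (y j) ≤ p := fun j => le_hasSum hp j fun i _ => hnn i
  have hyt := fun j => tendsto_cfcₙ_frameSumFun_mul hp0 (hyp j)
  let K : Submodule ℂ A :=
    { carrier := {x : A | Tendsto (fun N => cfcₙ (frameSumFun N) p * x) atTop (𝓝 x)}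
      zero_mem' := by simp
      add_mem' := fun {x z} hx hz => by
        simpa [mul_add] using Tendsto.add hx hz
      smul_mem' := fun c x hx => by
        simpa [mul_smul_comm] using Tendsto.const_smul hx c }
  have hKclosed : IsClosed (K : Set A) :=
    isClosed_setOf_tendsto_mul (norm_cfcₙ_frameSumFun_le p)
  have hKmul : ∀ x ∈ K, ∀ z, x * z ∈ K := fun x hx z => by
    have : Tendsto (fun N => cfcₙ (frameSumFun N) p * x * z) atTop (𝓝 (x * z)) :=
      Tendsto.mul_const z hx
    simp only [mul_assoc] at this
    exact this
  have heK : e ∈ K := by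
    refine closure_minimal (Submodule.span_le.2 ?_) hKclosed hab
    rintro _ ⟨j, rfl⟩
    have : a j * h * b j = y j * ((r j)⁻¹ • b j) := by
      simp only [y, smul_mul_assoc, mul_smul_comm, smul_smul]
      rw [inv_mul_cancel₀ (hr j).ne', one_smul]
    change a j * h * b j ∈ K
    rw [this]
    exact hKmul _ (hyt j) _
  have hKtop : ∀ x, x ∈ K := by
    intro x
    refine closure_minimal ?_ hKclosed (hdense x)
    rintro _ ⟨d, rfl⟩
    exact hKmul _ (hKmul _ heK _) _
  refine ⟨y, fun n => cfcₙ (frameFun n) p, p, fun j => ⟨r j • a j, (smul_mul_assoc _ _ _).symm⟩,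
    fun n => cfcₙ_predicate _ p, hp, fun c => ?_⟩
  have hlim : Tendsto (fun N => c * (cfcₙ (frameSumFun N) p * star c)) atTop (𝓝 (c * star c)) :=
    Tendsto.const_mul c (hKtop (star c))
  refine hlim.congr fun N => ?_
  rw [← Finset.sum_mul, ← Finset.mul_sum, sum_frameFun_conj p hp0, mul_assoc]

end Frame

section Extension

variable {A : Type*} [NonUnitalCStarAlgebra A] [PartialOrder A] [StarOrderedRing A]

lemma LscTraceOn.eq_tsum_frame {h : A} (hh : IsSelfAdjoint h) (T : LscTraceOn A (HereditarySub A h))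
    {y g : ℕ → A} {p : A} (hg : ∀ n, IsSelfAdjoint (g n))
    (hp : HasSum (fun j => y j * star (y j)) p)
    (hsum : ∀ c : A, Tendsto (fun N => ∑ n ∈ Finset.range N, c * (g n * p * g n) * star c) atTop
      (𝓝 (c * star c)))
    {c : A} (hc : ∀ z, c * z * star c ∈ HereditarySub A h) :
    T.toFun (c * star c) =
      ∑' k : ℕ × ℕ, T.toFun (c * (g k.1 * y k.2) * star (c * (g k.1 * y k.2))) := by
  have hp0 : 0 ≤ p := hp.nonneg fun j => mul_star_self_nonneg _
  rw [T.eq_tsum_of_tendsto hh (fun n => hc _) (fun n => ?_) (hsum c),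
    ENNReal.tsum_prod (f := fun n j => T.toFun (c * (g n * y j) * star (c * (g n * y j))))]
  · refine tsum_congr fun n => ?_
    have hgc : Continuous fun z => c * (g n * z * g n) * star c := by fun_prop
    refine T.eq_tsum_of_tendsto hh (fun j => ?_) (fun j => mul_star_self_nonneg _) ?_
    · have := hc (g n * y j * star (g n * y j))
      simpa only [star_mul, mul_assoc] using this
    · refine ((hgc.tendsto p).comp hp.tendsto_sum_nat).congr fun N => ?_
      simp only [Function.comp_apply, Finset.mul_sum, Finset.sum_mul, star_mul, (hg n).star_eq,
        mul_assoc]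
  · have h1 := star_left_conjugate_nonneg hp0 (g n)
    rw [(hg n).star_eq] at h1
    exact star_right_conjugate_nonneg h1 c

/-- In a simple C*-algebra, a trace which is finite on some nonzero positive element is densely
defined. -/
lemma mem_closure_of_trace_ne_top (hA : IsSimpleCStar A) (τ : A → ℝ≥0∞)
    (hadd : ∀ a b, 0 ≤ a → 0 ≤ b → τ (a + b) = τ a + τ b)
    (hsmul : ∀ (r : ℝ≥0) (a : A), 0 ≤ a → τ (((r : ℝ) : ℂ) • a) = r * τ a)
    (htr : ∀ x, τ (star x * x) = τ (x * star x))
    {b : A} (hb0 : 0 ≤ b) (hb : b ≠ 0) (hτb : τ b ≠ ∞) {a : A} (ha : 0 ≤ a) :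
    a ∈ closure {b | 0 ≤ b ∧ τ b ≠ ∞} := by
  have hmono : ∀ a b, 0 ≤ a → a ≤ b → τ b ≠ ∞ → τ a ≠ ∞ := by
    intro a b ha hab hb
    have := hadd a (b - a) ha (sub_nonneg.2 hab)
    rw [add_sub_cancel] at this
    exact ne_top_of_le_ne_top hb (this ▸ le_self_add)
  have hfin : ∀ (r : ℝ), 0 ≤ r → ∀ a, 0 ≤ a → τ a ≠ ∞ → τ (r • a) ≠ ∞ := by
    intro r hr a ha hfa
    lift r to ℝ≥0 using hr
    rw [← Complex.coe_smul, hsmul r a ha]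
    exact ENNReal.mul_ne_top ENNReal.coe_ne_top hfa
  have hleft : ∀ x, τ (star x * x) ≠ ∞ → ∀ a, τ (star (a * x) * (a * x)) ≠ ∞ := by
    intro x hx a
    refine hmono _ _ (star_mul_self_nonneg _) ?_
      (hfin ‖star a * a‖ (norm_nonneg _) _ (star_mul_self_nonneg x) hx)
    have := CStarAlgebra.star_left_conjugate_le_norm_smul (a := x) (.star_mul_self a)
    simpa only [star_mul, mul_assoc] using this
  have hstar : ∀ x, τ (star x * x) ≠ ∞ → τ (star (star x) * star x) ≠ ∞ := by
    intro x hx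
    rwa [star_star, ← htr]
  let N : Submodule ℂ A :=
    { carrier := {x | τ (star x * x) ≠ ∞}
      zero_mem' := by
        have := hfin 0 le_rfl b hb0 hτb
        simpa using this
      add_mem' := by
        intro x y hx hy
        refine hmono _ ((2 : ℝ) • (star x * x + star y * y)) (star_mul_self_nonneg _) ?_
          (hfin 2 (by norm_num) _ (add_nonneg (star_mul_self_nonneg _) (star_mul_self_nonneg _)) ?_)
        · rw [← sub_nonneg]
          convert star_mul_self_nonneg (x - y) using 1
          simp only [star_add, star_sub, two_smul]
          noncomm_ring
        · rw [hadd _ _ (star_mul_self_nonneg _) (star_mul_self_nonneg _)]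
          exact ENNReal.add_ne_top.2 ⟨hx, hy⟩
      smul_mem' := by
        intro c x hx
        have := hfin (‖c‖ ^ 2) (by positivity) _ (star_mul_self_nonneg x) hx
        have heq : star (c • x) * (c • x) = (‖c‖ ^ 2) • (star x * x) := by
          rw [star_smul, smul_mul_smul_comm, ← Complex.coe_smul]
          congr 1
          simpa using Complex.conj_mul' c
        change τ (star (c • x) * (c • x)) ≠ ∞
        rwa [heq] }
  have hmulleft : ∀ x ∈ N, ∀ a, a * x ∈ N := fun x hx a => hleft x hx a
  have hstarN : ∀ x ∈ N, star x ∈ N := fun x hx => hstar x hx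
  have hmulright : ∀ x ∈ N, ∀ a, x * a ∈ N := fun x hx a => by
    simpa using hstarN _ (hmulleft _ (hstarN x hx) (star a))
  have htop : N.topologicalClosure = ⊤ := by
    refine (hA.2 N.topologicalClosure (fun x hx a => ⟨?_, ?_⟩)
      (Submodule.isClosed_topologicalClosure _)).resolve_left fun hbot => ?_
    · exact map_mem_closure (f := fun x => a * x) (by fun_prop) hx fun x hx => hmulleft x hx a
    · exact map_mem_closure (f := fun x => x * a) (by fun_prop) hx fun x hx => hmulright x hx a
    · have hss : CFC.sqrt b * CFC.sqrt b = b := CFC.sqrt_mul_sqrt_self b hb0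
      have hmem : CFC.sqrt b ∈ N := by
        change τ (star (CFC.sqrt b) * CFC.sqrt b) ≠ ∞
        rwa [(IsSelfAdjoint.of_nonneg (CFC.sqrt_nonneg b)).star_eq, hss]
      have hz := N.le_topologicalClosure hmem
      rw [hbot, Submodule.mem_bot] at hz
      exact hb (by rw [← hss, hz, mul_zero])
  have hsq : star (CFC.sqrt a) * CFC.sqrt a = a := by
    rw [(IsSelfAdjoint.of_nonneg (CFC.sqrt_nonneg a)).star_eq, CFC.sqrt_mul_sqrt_self a ha]
  have hmem : CFC.sqrt a ∈ closure (N : Set A) := by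
    change CFC.sqrt a ∈ N.topologicalClosure
    simp [htop]
  rw [← hsq]
  exact map_mem_closure (f := fun x => star x * x) (by fun_prop) hmem
    fun x hx => ⟨star_mul_self_nonneg x, hx⟩

end Extension

/-- **Corollary 2.4.**  For a simple σ-unital C*-algebra `A` and a nonzero positive
`h ∈ A`, every densely defined lower semicontinuous trace on the hereditary subalgebra
`\overline{hAh}` is the restriction of a densely defined lower semicontinuous trace
on `A`. -/
theorem trace_on_hereditary_extends
    {A : Type u} [NonUnitalCStarAlgebra A] [PartialOrder A] [StarOrderedRing A]
    (hA : IsSimpleCStar A) (hσ : SigmaUnital A) (h : A) (hpos : 0 ≤ h) (hne : h ≠ 0)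
    (T : LscTraceOn A (HereditarySub A h)) :
    ∃ T' : LscTrace A, ∀ x ∈ HereditarySub A h, 0 ≤ x → T'.toFun x = T.toFun x := by


  have hh : IsSelfAdjoint h := .of_nonneg hpos
  obtain ⟨y, g, p, hy, hg, hp, hsum⟩ := exists_frame hA hσ hpos hne
  obtain ⟨x, hx, hkey⟩ : ∃ x : ℕ × ℕ → A, (∀ k, ∃ a, x k = a * h) ∧
      ∀ c : A, (∀ z, c * z * star c ∈ HereditarySub A h) →
        T.toFun (c * star c) = ∑' k, T.toFun (c * x k * star (c * x k)) := by
    refine ⟨fun k => g k.1 * y k.2, fun k => ?_, fun c => T.eq_tsum_frame hh hg hp hsum⟩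
    obtain ⟨a, ha⟩ := hy k.2
    exact ⟨g k.1 * a, by simp only [ha, mul_assoc]⟩
  have hxx : ∀ k l z, star (x k) * z * x l ∈ HereditarySub A h := by
    intro k l z
    obtain ⟨a, ha⟩ := hx k
    obtain ⟨b, hb⟩ := hx l
    have := mul_mul_mem_hereditarySub h (star a * z * b)
    simpa only [ha, hb, star_mul, hh.star_eq, mul_assoc] using this
  have hnn : ∀ k a, 0 ≤ a → 0 ≤ star (x k) * a * x k :=
    fun k a ha => star_left_conjugate_nonneg ha _
  let τ : A → ℝ≥0∞ := fun a => ∑' k, T.toFun (star (x k) * a * x k)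
  have hadd : ∀ a b, 0 ≤ a → 0 ≤ b → τ (a + b) = τ a + τ b := by
    intro a b ha hb
    simp only [τ]
    rw [← ENNReal.tsum_add]
    refine tsum_congr fun k => ?_
    rw [mul_add, add_mul]
    exact T.map_add _ (hxx k k a) _ (hxx k k b) (hnn k a ha) (hnn k b hb)
  have hsmul : ∀ (r : ℝ≥0) (a : A), 0 ≤ a → τ (((r : ℝ) : ℂ) • a) = r * τ a := by
    intro r a ha
    simp only [τ]
    rw [← ENNReal.tsum_mul_left]
    refine tsum_congr fun k => ?_
    rw [mul_smul_comm, smul_mul_assoc]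
    exact T.map_smul r _ (hxx k k a) (hnn k a ha)
  have hexp : ∀ z : A, τ (star z * z) =
      ∑' k, ∑' l, T.toFun (star (x k) * star z * x l * star (star (x k) * star z * x l)) := by
    intro z
    refine tsum_congr fun k => ?_
    have := hkey (star (x k) * star z) fun w => by
      have := hxx k k (star z * w * z)
      simpa only [star_mul, star_star, mul_assoc] using this
    simpa only [star_mul, star_star, mul_assoc] using this
  have htr : ∀ z, τ (star z * z) = τ (z * star z) := by
    intro z
    have h2 := hexp (star z)
    rw [star_star] at h2
    rw [hexp, h2, ENNReal.tsum_comm]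
    refine tsum_congr fun l => tsum_congr fun k => ?_
    rw [← T.tracial _ (hxx k l (star z))]
    simp only [star_mul, star_star, mul_assoc]
  have hres : ∀ b ∈ HereditarySub A h, 0 ≤ b → τ b = T.toFun b := by
    intro b hb hb0
    set c := CFC.sqrt b
    have hc : c ∈ HereditarySub A h := sqrt_mem_hereditarySub hh hb hb0
    have hcs : star c = c := (IsSelfAdjoint.of_nonneg (CFC.sqrt_nonneg b)).star_eq
    have hcc : c * c = b := CFC.sqrt_mul_sqrt_self b hb0
    have := hkey c (conj_mem_hereditarySub hh hc)
    rw [hcs, hcc] at this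
    rw [this]
    refine tsum_congr fun k => ?_
    obtain ⟨a, ha⟩ := hx k
    have hmem : c * x k ∈ HereditarySub A h := ha ▸ mul_mem_hereditarySub_of_mem_left hc a
    rw [← T.tracial (c * x k) hmem, ← hcc, star_mul, hcs]
    simp only [mul_assoc]
  have hlsc : LowerSemicontinuousOn τ {a | a ∈ Set.univ ∧ 0 ≤ a} := by
    refine lowerSemicontinuousOn_tsum fun k => ?_
    exact T.lsc.comp (g := fun a => star (x k) * a * x k) (by fun_prop)
      fun a ha => ⟨hxx k k a, hnn k a ha.2⟩
  obtain ⟨b, hbmem, hb0, hbτ, hbne⟩ :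
      ∃ b ∈ HereditarySub A h, 0 ≤ b ∧ T.toFun b ≠ ∞ ∧ b ≠ 0 := by
    by_contra! hcon
    have hsub : {b | b ∈ HereditarySub A h ∧ 0 ≤ b ∧ T.toFun b ≠ ∞} ⊆ {0} :=
      fun b hb => hcon b hb.1 hb.2.1 hb.2.2
    have h3 : h * h * h = 0 := by
      have := closure_mono hsub (T.densely_defined (h * h * h) (mul_mul_mem_hereditarySub h h)
        (by simpa only [hh.star_eq] using star_left_conjugate_nonneg hpos h))
      simpa using this
    have h4 : star (h * h) * (h * h) = 0 := by
      rw [star_mul, hh.star_eq, ← mul_assoc, h3, zero_mul]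
    have h5 : star h * h = 0 := by
      rw [hh.star_eq, (CStarRing.star_mul_self_eq_zero_iff _).1 h4]
    exact hne ((CStarRing.star_mul_self_eq_zero_iff _).1 h5)
  exact ⟨{ toFun := τ
           map_add := fun a _ b _ => hadd a b
           map_smul := fun r a _ => hsmul r a
           tracial := fun z _ => htr z
           lsc := hlsc
           densely_defined := fun a _ ha => by
             simpa using mem_closure_of_trace_ne_top hA τ hadd hsmul htr hb0 hbne
               (by rwa [hres b hbmem hb0]) ha }, hres⟩

end Paper
end
end

section
/- Let A be a σ-unital simple C*-algebra. Then there exists a full hereditary C*-subalgebra B of A such that every densely defined lower semicontinuous trace on B is bounded. -/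
open scoped MultiplierAlgebra Kronecker
open Filter Topology
open scoped ENNReal NNReal

set_option linter.unusedSectionVars false
set_option synthInstance.maxHeartbeats 1000000
set_option maxHeartbeats 1000000

noncomputable section

universe u v w

namespace Paper

section LocalUnit

variable {A : Type*} [NonUnitalCStarAlgebra A] [PartialOrder A] [StarOrderedRing A]

/-- The elements on which `e` acts as a two-sided unit. -/
def localUnitSub (e : A) : Set A := {x | e * x = x ∧ x * e = x}

lemma mul_mul_mem_localUnitSub {e x y : A} (hx : x ∈ localUnitSub e) (hy : y ∈ localUnitSub e)
    (z : A) : x * z * y ∈ localUnitSub e :=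
  ⟨by rw [← mul_assoc, ← mul_assoc, hx.1], by rw [mul_assoc, hy.2]⟩

lemma mul_right_eq_zero_of_nonneg_of_le {a b u : A} (ha : 0 ≤ a) (hab : a ≤ b)
    (hu : b * u = 0) : CFC.sqrt a * u = 0 := by
  have h : star u * a * u = 0 := by
    refine le_antisymm ?_ (star_left_conjugate_nonneg ha u)
    simpa [mul_assoc, hu] using star_left_conjugate_le_conjugate hab u
  rw [← CStarRing.star_mul_self_eq_zero_iff, star_mul, (CFC.sqrt_nonneg a).isSelfAdjoint.star_eq,
    mul_assoc, ← mul_assoc (CFC.sqrt a), CFC.sqrt_mul_sqrt_self a ha, ← mul_assoc, h]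

lemma sqrt_mem_localUnitSub_of_le {e a b : A} (he : IsSelfAdjoint e) (ha : 0 ≤ a) (hab : a ≤ b)
    (hb : b ∈ localUnitSub e) : CFC.sqrt a ∈ localUnitSub e := by
  have hsa : star (CFC.sqrt a) = CFC.sqrt a := (CFC.sqrt_nonneg a).isSelfAdjoint.star_eq
  have key (u : A) : (CFC.sqrt a - CFC.sqrt a * e) * u = 0 := by
    have hbu : b * (u - e * u) = 0 := by rw [mul_sub, ← mul_assoc, hb.2, sub_self]
    have := mul_right_eq_zero_of_nonneg_of_le ha hab hbu
    rw [sub_mul, mul_assoc, ← mul_sub, this]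
  have hr : CFC.sqrt a * e = CFC.sqrt a :=
    (sub_eq_zero.1 <| (CStarRing.mul_star_self_eq_zero_iff _).1 (key _)).symm
  refine ⟨?_, hr⟩
  simpa [hsa, he.star_eq] using congrArg star hr

lemma isHereditarySubalgebra_localUnitSub {e : A} (he : IsSelfAdjoint e) :
    IsHereditarySubalgebra A (localUnitSub e) where
  isClosed := (isClosed_eq (by fun_prop) continuous_id).inter
    (isClosed_eq (by fun_prop) continuous_id)
  zero_mem := by simp [localUnitSub]
  add_mem x hx y hy := ⟨by rw [mul_add, hx.1, hy.1], by rw [add_mul, hx.2, hy.2]⟩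
  smul_mem c x hx := ⟨by rw [mul_smul_comm, hx.1], by rw [smul_mul_assoc, hx.2]⟩
  mul_mem x hx y hy := ⟨by rw [← mul_assoc, hx.1], by rw [mul_assoc, hy.2]⟩
  star_mem x hx := ⟨by simpa [he.star_eq] using congrArg star hx.2,
    by simpa [he.star_eq] using congrArg star hx.1⟩
  hereditary a b ha hab hb := by
    have h := sqrt_mem_localUnitSub_of_le he ha hab hb
    rw [← CFC.sqrt_mul_sqrt_self a ha]
    exact ⟨by rw [← mul_assoc, h.1], by rw [mul_assoc, h.2]⟩

lemma exists_selfAdjoint_mem_localUnitSub_ne_zero (hA : ∃ x : A, x ≠ 0) :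
    ∃ e h : A, IsSelfAdjoint e ∧ h ∈ localUnitSub e ∧ h ≠ 0 := by
  obtain ⟨x, hx⟩ := hA
  obtain ⟨a, ha, ha0⟩ : ∃ a : A, 0 ≤ a ∧ a ≠ 0 :=
    ⟨star x * x, star_mul_self_nonneg x, by simpa [CStarRing.star_mul_self_eq_zero_iff] using hx⟩
  have hN : 0 < ‖a‖ := norm_pos_iff.2 ha0
  let f : ℝ → ℝ := fun t ↦ min 1 (2 * t / ‖a‖)
  let g : ℝ → ℝ := fun t ↦ max (t - ‖a‖ / 2) 0
  have hf : Continuous f := by fun_prop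
  have hg : Continuous g := by fun_prop
  have hf0 : f 0 = 0 := by simp [f]
  have hg0 : g 0 = 0 := by simp only [g, max_eq_right_iff]; linarith
  have hfg (t : ℝ) : f t * g t = g t := by
    rcases le_total t (‖a‖ / 2) with ht | ht
    · have : g t = 0 := max_eq_right (by linarith)
      simp [this]
    · have : f t = 1 := min_eq_left (by rw [le_div_iff₀ hN]; linarith)
      simp [this]
  have hfg' : cfcₙ f a * cfcₙ g a = cfcₙ g a := by
    rw [← cfcₙ_mul f g a hf.continuousOn hf0 hg.continuousOn hg0]
    simp only [hfg]
  have hgf' : cfcₙ g a * cfcₙ f a = cfcₙ g a := by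
    rw [← cfcₙ_mul g f a hg.continuousOn hg0 hf.continuousOn hf0]
    simp only [mul_comm (g _), hfg]
  refine ⟨cfcₙ f a, cfcₙ g a, cfcₙ_predicate f a, ⟨hfg', hgf'⟩, fun h0 ↦ ?_⟩
  have heq : (quasispectrum ℝ a).EqOn g (fun _ ↦ 0) :=
    eqOn_of_cfcₙ_eq_cfcₙ (h0.trans (cfcₙ_const_zero ℝ a).symm) ha.isSelfAdjoint hg.continuousOn hg0
  have hle : ‖cfcₙ (id : ℝ → ℝ) a‖ ≤ ‖a‖ / 2 := by
    refine norm_cfcₙ_le fun t ht ↦ ?_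
    have h1 : 0 ≤ t := quasispectrum_nonneg_of_nonneg a ha t ht
    have h2 : t - ‖a‖ / 2 ≤ 0 := max_eq_right_iff.1 (heq ht)
    rw [id, Real.norm_of_nonneg h1]
    linarith
  rw [cfcₙ_id ℝ a ha.isSelfAdjoint] at hle
  linarith

/-- The cone generated by the conjugates `star z * b * z`. -/
def conjCone (b : A) : AddSubmonoid A := AddSubmonoid.closure {c | ∃ z, c = star z * b * z}

lemma nonneg_of_mem_conjCone {b c : A} (hb : 0 ≤ b) (hc : c ∈ conjCone b) : 0 ≤ c := by
  induction hc using AddSubmonoid.closure_induction with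
  | mem c hc =>
    obtain ⟨z, rfl⟩ := hc
    exact star_left_conjugate_nonneg hb z
  | zero => exact le_rfl
  | add x y _ _ hx hy => exact add_nonneg hx hy

lemma exists_add_star_le_mem_conjCone {b s : A} (hb : 0 ≤ b)
    (hs : s ∈ Submodule.span ℂ {s : A | ∃ x y, s = x * b * y}) :
    ∃ c ∈ conjCone b, s + star s ≤ c := by
  suffices ∀ k : ℂ, ∃ c ∈ conjCone b, k • s + star (k • s) ≤ c by simpa using this 1
  induction hs using Submodule.span_induction with
  | mem s hs =>
    obtain ⟨x, y, rfl⟩ := hs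
    intro k
    refine ⟨star (star (k • x)) * b * star (k • x) + star y * b * y,
      add_mem (AddSubmonoid.subset_closure ⟨_, rfl⟩) (AddSubmonoid.subset_closure ⟨_, rfl⟩), ?_⟩
    have h := star_left_conjugate_nonneg hb (star (k • x) - y)
    rw [← sub_nonneg]
    convert h using 1
    rw [← smul_mul_assoc, ← smul_mul_assoc]
    simp only [star_sub, star_star, star_mul, hb.isSelfAdjoint.star_eq]
    noncomm_ring
  | zero => exact fun k ↦ ⟨0, zero_mem _, by simp⟩
  | add x y _ _ hx hy =>
    intro k
    obtain ⟨c, hc, hxc⟩ := hx k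
    obtain ⟨d, hd, hyd⟩ := hy k
    refine ⟨c + d, add_mem hc hd, ?_⟩
    convert! add_le_add hxc hyd using 1
    rw [smul_add, star_add]
    abel
  | smul m x _ hx => exact fun k ↦ by simpa only [smul_smul] using hx (k * m)

lemma IsSimpleCStar.dense_span_mul_mul (hA : IsSimpleCStar A) {b : A} (hb : 0 ≤ b) (hb0 : b ≠ 0) :
    Dense (Submodule.span ℂ {s : A | ∃ x y, s = x * b * y} : Set A) := by
  set J := Submodule.span ℂ {s : A | ∃ x y, s = x * b * y}
  have hmul (a : A) : (∀ s ∈ J, a * s ∈ J) ∧ ∀ s ∈ J, s * a ∈ J := by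
    refine ⟨fun s hs ↦ ?_, fun s hs ↦ ?_⟩
    · refine (Submodule.span_le (p := J.comap (LinearMap.mulLeft ℂ a))).2 ?_ hs
      rintro _ ⟨x, y, rfl⟩
      exact Submodule.subset_span ⟨a * x, y, by simp [mul_assoc]⟩
    · refine (Submodule.span_le (p := J.comap (LinearMap.mulRight ℂ a))).2 ?_ hs
      rintro _ ⟨x, y, rfl⟩
      exact Submodule.subset_span ⟨x, y * a, by simp [mul_assoc]⟩
  have hideal : ∀ s ∈ J.topologicalClosure, ∀ a : A,
      a * s ∈ J.topologicalClosure ∧ s * a ∈ J.topologicalClosure := fun s hs a ↦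
    ⟨map_mem_closure (continuous_const_mul a) hs (hmul a).1,
      map_mem_closure (f := (· * a)) (continuous_mul_const a) hs (hmul a).2⟩
  rcases hA.2 _ hideal J.isClosed_topologicalClosure with h | h
  · have hbbb : b * b * b = 0 := by
      rw [← Submodule.mem_bot ℂ, ← h]
      exact J.le_topologicalClosure (Submodule.subset_span ⟨b, b, rfl⟩)
    have hbs := hb.isSelfAdjoint.star_eq
    have hbb : b * b = 0 := by
      rw [← CStarRing.star_mul_self_eq_zero_iff, star_mul, hbs, ← mul_assoc, hbbb, zero_mul]
    exact absurd ((CStarRing.star_mul_self_eq_zero_iff b).1 (by rw [hbs, hbb])) hb0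
  · exact (Submodule.dense_iff_topologicalClosure_eq_top).2 h

lemma IsSimpleCStar.exists_sqrt_conj_ge (hA : IsSimpleCStar A) {e b : A} (he : IsSelfAdjoint e)
    (hb : 0 ≤ b) (hb0 : b ≠ 0) :
    ∃ c ∈ conjCone b, ∀ a ∈ localUnitSub e, 0 ≤ a → a ≤ CFC.sqrt a * c * CFC.sqrt a := by
  obtain ⟨s, hs, hes⟩ := (hA.dense_span_mul_mul hb hb0).exists_dist_lt e
    (show (0 : ℝ) < 1 / 2 by norm_num)
  obtain ⟨c, hc, hsc⟩ := exists_add_star_le_mem_conjCone hb hs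
  refine ⟨c, hc, fun a ha ha0 ↦ ?_⟩
  have hsq := sqrt_mem_localUnitSub_of_le he ha0 le_rfl ha
  have hsa : star (CFC.sqrt a) = CFC.sqrt a := (CFC.sqrt_nonneg a).isSelfAdjoint.star_eq
  have hk : ‖(e - s) + star (e - s)‖ ≤ 1 := by
    refine (norm_add_le _ _).trans ?_
    rw [norm_star, ← dist_eq_norm]
    linarith
  have h1 : CFC.sqrt a * ((e - s) + star (e - s)) * CFC.sqrt a ≤ a := by
    have := CStarAlgebra.star_left_conjugate_le_norm_smul (a := CFC.sqrt a)
      (b := (e - s) + star (e - s)) (IsSelfAdjoint.add_star_self _)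
    rw [hsa, CFC.sqrt_mul_sqrt_self a ha0] at this
    exact this.trans (smul_le_of_le_one_left ha0 hk)
  have h2 := star_left_conjugate_le_conjugate hsc (CFC.sqrt a)
  rw [hsa] at h2
  have h3 : CFC.sqrt a * e * CFC.sqrt a = a := by rw [hsq.2, CFC.sqrt_mul_sqrt_self a ha0]
  have h4 : CFC.sqrt a * ((e - s) + star (e - s)) * CFC.sqrt a
      = a + a - CFC.sqrt a * (s + star s) * CFC.sqrt a := by
    nth_rewrite 3 4 [← h3]
    rw [star_sub, he.star_eq]
    noncomm_ring
  rw [h4, sub_le_iff_le_add] at h1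
  exact (le_of_add_le_add_left h1).trans h2

lemma LscTraceOn.map_zero_s13 {S : Set A} (hS : IsHereditarySubalgebra A S) (T : LscTraceOn A S) :
    T.toFun 0 = 0 := by
  simpa using T.map_smul 0 0 hS.zero_mem le_rfl

lemma LscTraceOn.mono_s13 {S : Set A} (hS : IsHereditarySubalgebra A S) (T : LscTraceOn A S)
    {a b : A} (ha : 0 ≤ a) (hab : a ≤ b) (hb : b ∈ S) : T.toFun a ≤ T.toFun b := by
  have h := T.map_add a (hS.hereditary a b ha hab hb) (b - a)
    (hS.hereditary _ b (sub_nonneg.2 hab) (sub_le_self b ha) hb) ha (sub_nonneg.2 hab)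
  rw [add_sub_cancel] at h
  exact h ▸ le_self_add

lemma LscTraceOn.le_of_mem_conjCone {e b c : A} (he : IsSelfAdjoint e)
    (T : LscTraceOn A (localUnitSub e)) (hb : b ∈ localUnitSub e) (hb0 : 0 ≤ b)
    (hc : c ∈ conjCone b) :
    ∃ C : ℝ≥0, ∀ a ∈ localUnitSub e, 0 ≤ a → ‖a‖ ≤ 1 →
      T.toFun (CFC.sqrt a * c * CFC.sqrt a) ≤ C * T.toFun b := by
  have hS := isHereditarySubalgebra_localUnitSub he
  have hsa (a : A) : star (CFC.sqrt a) = CFC.sqrt a := (CFC.sqrt_nonneg a).isSelfAdjoint.star_eq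
  induction hc using AddSubmonoid.closure_induction with
  | mem c hc =>
    obtain ⟨z, rfl⟩ := hc
    refine ⟨‖z * star z‖₊, fun a ha ha0 ha1 ↦ ?_⟩
    have hra := sqrt_mem_localUnitSub_of_le he ha0 le_rfl ha
    have hrb := sqrt_mem_localUnitSub_of_le he hb0 le_rfl hb
    have hx := mul_mul_mem_localUnitSub hrb hra z
    have h1 : CFC.sqrt a * (star z * b * z) * CFC.sqrt a
        = star (CFC.sqrt b * z * CFC.sqrt a) * (CFC.sqrt b * z * CFC.sqrt a) := by
      nth_rewrite 1 [← CFC.sqrt_mul_sqrt_self b hb0]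
      simp only [star_mul, hsa, mul_assoc]
    have h2 : CFC.sqrt b * z * CFC.sqrt a * star (CFC.sqrt b * z * CFC.sqrt a)
        = CFC.sqrt b * z * a * star (CFC.sqrt b * z) := by
      nth_rewrite 3 [← CFC.sqrt_mul_sqrt_self a ha0]
      simp only [star_mul, hsa, mul_assoc]
    have h3 : CFC.sqrt b * z * a * star (CFC.sqrt b * z) ≤ ‖z * star z‖ • b := by
      calc CFC.sqrt b * z * a * star (CFC.sqrt b * z)
          ≤ ‖a‖ • (CFC.sqrt b * z * star (CFC.sqrt b * z)) :=
            CStarAlgebra.star_right_conjugate_le_norm_smul ha0.isSelfAdjoint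
        _ ≤ CFC.sqrt b * z * star (CFC.sqrt b * z) :=
            smul_le_of_le_one_left (mul_star_self_nonneg _) ha1
        _ = CFC.sqrt b * (z * star z) * star (CFC.sqrt b) := by
            simp only [star_mul, mul_assoc]
        _ ≤ ‖z * star z‖ • (CFC.sqrt b * star (CFC.sqrt b)) :=
            CStarAlgebra.star_right_conjugate_le_norm_smul (IsSelfAdjoint.mul_star_self z)
        _ = ‖z * star z‖ • b := by rw [hsa, CFC.sqrt_mul_sqrt_self b hb0]
    have h4 : ((‖z * star z‖₊ : ℝ) : ℂ) • b = ‖z * star z‖ • b := by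
      rw [coe_nnnorm, Complex.coe_smul]
    rw [h1, T.tracial _ hx, h2, ← T.map_smul _ b hb hb0]
    refine T.mono_s13 hS (star_right_conjugate_nonneg ha0 _) (h3.trans_eq h4.symm) ?_
    exact hS.smul_mem _ _ hb
  | zero => exact ⟨0, fun a _ _ _ ↦ by simp [T.map_zero_s13 hS]⟩
  | add x y hx hy ihx ihy =>
    obtain ⟨C, hC⟩ := ihx
    obtain ⟨D, hD⟩ := ihy
    refine ⟨C + D, fun a ha ha0 ha1 ↦ ?_⟩
    have hra := sqrt_mem_localUnitSub_of_le he ha0 le_rfl ha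
    have hpos {w : A} (hw : w ∈ conjCone b) : 0 ≤ CFC.sqrt a * w * CFC.sqrt a :=
      conjugate_nonneg_of_nonneg (nonneg_of_mem_conjCone hb0 hw) (CFC.sqrt_nonneg a)
    rw [mul_add, add_mul, T.map_add _ (mul_mul_mem_localUnitSub hra hra x) _
      (mul_mul_mem_localUnitSub hra hra y) (hpos hx) (hpos hy), ENNReal.coe_add, add_mul]
    exact add_le_add (hC a ha ha0 ha1) (hD a ha ha0 ha1)

lemma LscTraceOn.exists_ne_zero_ne_top {S : Set A} (T : LscTraceOn A S) {a : A} (ha : a ∈ S)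
    (ha0 : 0 ≤ a) (hne : a ≠ 0) : ∃ b ∈ S, 0 ≤ b ∧ b ≠ 0 ∧ T.toFun b ≠ ∞ := by
  obtain ⟨b, hb, hbS, hb0, hbT⟩ := mem_closure_iff.1 (T.densely_defined a ha ha0) {0}ᶜ
    isOpen_compl_singleton hne
  exact ⟨b, hbS, hb0, hb, hbT⟩

lemma IsSimpleCStar.exists_trace_bound (hA : IsSimpleCStar A) {e h : A} (he : IsSelfAdjoint e)
    (hh : h ∈ localUnitSub e) (hh0 : h ≠ 0) (T : LscTraceOn A (localUnitSub e)) :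
    ∃ C : ℝ≥0, ∀ a ∈ localUnitSub e, 0 ≤ a → ‖a‖ ≤ 1 → T.toFun a ≤ (C : ℝ≥0∞) := by
  have hS := isHereditarySubalgebra_localUnitSub he
  obtain ⟨b, hb, hb0, hbne, hbT⟩ := T.exists_ne_zero_ne_top
    (hS.mul_mem _ (hS.star_mem _ hh) _ hh) (star_mul_self_nonneg h)
    (by simpa [CStarRing.star_mul_self_eq_zero_iff] using hh0)
  obtain ⟨c, hc, hac⟩ := hA.exists_sqrt_conj_ge he hb0 hbne
  obtain ⟨C, hC⟩ := T.le_of_mem_conjCone he hb hb0 hc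
  refine ⟨C * (T.toFun b).toNNReal, fun a ha ha0 ha1 ↦ ?_⟩
  have hra := sqrt_mem_localUnitSub_of_le he ha0 le_rfl ha
  rw [ENNReal.coe_mul, ENNReal.coe_toNNReal hbT]
  exact (T.mono_s13 hS ha0 (hac a ha ha0) (mul_mul_mem_localUnitSub hra hra c)).trans
    (hC a ha ha0 ha1)

end LocalUnit

/-- **Proposition 5.2.**  Every σ-unital simple C*-algebra has a full hereditary
subalgebra on which every densely defined lower semicontinuous trace is bounded. -/
theorem exists_full_hereditary_bounded_traces
    {A : Type u} [NonUnitalCStarAlgebra A] [PartialOrder A] [StarOrderedRing A]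
    (hσ : SigmaUnital A) (hA : IsSimpleCStar A) :
    ∃ B : Set A, IsHereditarySubalgebra A B ∧
      (∀ I : Submodule ℂ A, (∀ x ∈ I, ∀ a : A, a * x ∈ I ∧ x * a ∈ I) →
        IsClosed (I : Set A) → B ⊆ I → I = ⊤) ∧
      ∀ T : LscTraceOn A B, ∃ C : ℝ≥0,
        ∀ a ∈ B, 0 ≤ a → ‖a‖ ≤ 1 → T.toFun a ≤ (C : ℝ≥0∞) := by
  obtain ⟨e, h, he, hh, hh0⟩ := exists_selfAdjoint_mem_localUnitSub_ne_zero hA.1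
  refine ⟨localUnitSub e, isHereditarySubalgebra_localUnitSub he, fun I hI hIc hBI ↦ ?_,
    fun T ↦ hA.exists_trace_bound he hh hh0 T⟩
  refine (hA.2 I hI hIc).resolve_left fun hbot ↦ hh0 ?_
  rw [← Submodule.mem_bot ℂ, ← hbot]
  exact hBI hh

end Paper
end
end
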